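/- arXiv:1706.03733 — 13 statements merged into one kernel-verified Lean document; each statement's English description precedes it below -/
import Mathlib

section
/- Let K be a field and 𝔽 ⊆ K a subfield with at least m elements (m ≥ 1). Let v_1,…,v_m be additive valuations on K with values in ℤ ∪ {∞} such that v_j(c) = 0 for every nonzero c ∈ 𝔽 and every j. Let α = (α_1,…,α_m) ∈ ℤ^m and let f_1,…,f_m ∈ K satisfy v_j(f_i) ≥ −α_j for all i, j ∈ {1,…,m} and v_i(f_i) = −α_i for every i. Then there exist b_1,…,b_m ∈ 𝔽 such that the element f = b_1 f_1 + … + b_m f_m satisfies v_j(f) = −α_j for every j ∈ {1,…,m}. -/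
/-- Given a field `K`, a subfield `F` with at least `m` elements,
additive valuations `v 1, …, v m` on `K` with values in `ℤ ∪ {∞}` (here `WithTop ℤ`)
that vanish on nonzero elements of `F`, and functions `f 1, …, f m` with
`v j (f i) ≥ -α j` for all `i, j` and `v i (f i) = -α i`, there exist coefficients
`b i ∈ F` such that `f = ∑ b i * f i` satisfies `v j f = -α j` for every `j`. -/
theorem statement0 (m : ℕ) (hm : 1 ≤ m) (K : Type*) [Field K] (F : Subfield K)
    (hF : (m : Cardinal) ≤ Cardinal.mk F)
    (v : Fin m → K → WithTop ℤ)
    (hv0 : ∀ j, v j 0 = ⊤)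
    (hv1 : ∀ j, v j 1 = 0)
    (hvmul : ∀ j x y, v j (x * y) = v j x + v j y)
    (hvadd : ∀ j x y, min (v j x) (v j y) ≤ v j (x + y))
    (hvF : ∀ j, ∀ c ∈ F, c ≠ 0 → v j c = 0)
    (α : Fin m → ℤ) (f : Fin m → K)
    (hge : ∀ i j, ((-(α j) : ℤ) : WithTop ℤ) ≤ v j (f i))
    (heq : ∀ i, v i (f i) = ((-(α i) : ℤ) : WithTop ℤ)) :
    ∃ b : Fin m → K, (∀ i, b i ∈ F) ∧
      ∀ j, v j (∑ i, b i * f i) = ((-(α j) : ℤ) : WithTop ℤ) := by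
  have hsc : ∀ j, ∀ a : WithTop ℤ, ∀ c ∈ F, ∀ x, a ≤ v j x → a ≤ v j (c * x) := by
    intro j a c hc x hx
    by_cases h0 : c = 0
    · subst h0; rw [zero_mul, hv0]; exact le_top
    · rw [hvmul, hvF j c hc h0, zero_add]; exact hx
  have hsc' : ∀ j, ∀ c ∈ F, c ≠ 0 → ∀ x, v j (c * x) = v j x := by
    intro j c hc h0 x
    rw [hvmul, hvF j c hc h0, zero_add]
  have hneg : ∀ j x, v j (-x) = v j x := by
    intro j x
    have := hsc' j (-1) (F.neg_mem F.one_mem) (neg_ne_zero.mpr one_ne_zero) x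
    simpa using this
  have hL : ∀ b : Fin m → K, (∀ i, b i ∈ F) → ∀ j,
      ((-(α j) : ℤ) : WithTop ℤ) ≤ v j (∑ i, b i * f i) := by
    intro b hb j
    refine Finset.sum_induction _ (fun x => ((-(α j) : ℤ) : WithTop ℤ) ≤ v j x) ?_ ?_ ?_
    · intro x y hx hy
      exact (le_min hx hy).trans (hvadd j x y)
    · rw [hv0]; exact le_top
    · intro i _
      exact hsc j _ _ (hb i) _ (hge i j)
  have key : ∀ s : Finset (Fin m), ∃ b : Fin m → K, (∀ i, b i ∈ F) ∧
      ∀ j ∈ s, v j (∑ i, b i * f i) = ((-(α j) : ℤ) : WithTop ℤ) := by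
    intro s
    induction s using Finset.induction_on with
    | empty => exact ⟨fun _ => 0, fun _ => F.zero_mem, by simp⟩
    | insert k s hk ih =>
      obtain ⟨b, hb, hg⟩ := ih
      by_cases hbk : v k (∑ i, b i * f i) = ((-(α k) : ℤ) : WithTop ℤ)
      · refine ⟨b, hb, fun j hj => ?_⟩
        rcases Finset.mem_insert.mp hj with rfl | hj
        · exact hbk
        · exact hg j hj
      have hgk := lt_of_le_of_ne (hL b hb k) (Ne.symm hbk)
      have hsum : ∀ c : K, ∑ i, ((if i = k then 1 else 0) + c * b i) * f i
          = f k + c * ∑ i, b i * f i := by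
        intro c
        simp [add_mul, Finset.sum_add_distrib, Finset.mul_sum, mul_assoc]
      have hmem : ∀ c ∈ F, ∀ i, ((if i = k then 1 else 0) + c * b i) ∈ F := by
        intro c hc i
        refine F.add_mem ?_ (F.mul_mem hc (hb i))
        split_ifs
        · exact F.one_mem
        · exact F.zero_mem
      have hex : ∃ c : F, ∀ j ∈ s, v j (f k + c * ∑ i, b i * f i)
          = ((-(α j) : ℤ) : WithTop ℤ) := by
        by_contra! hcon
        choose φ hφs hφ using hcon
        have hinj : Function.Injective (fun c => (⟨φ c, hφs c⟩ : s)) := by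
          intro c d hcd
          have hcd' : φ c = φ d := congrArg Subtype.val hcd
          by_contra hne
          have gt : ∀ c : F, ((-(α (φ c)) : ℤ) : WithTop ℤ)
              < v (φ c) (f k + c * ∑ i, b i * f i) := by
            intro c
            refine lt_of_le_of_ne ?_ (hφ c).symm
            rw [← hsum]
            exact hL _ (hmem c c.2) _
          have h1 := gt c
          have h2 := gt d
          rw [← hcd', ← hneg] at h2
          have h3 := (lt_min h1 h2).trans_le (hvadd _ _ _)
          have e : (f k + (c : K) * ∑ i, b i * f i) + -(f k + (d : K) * ∑ i, b i * f i)
              = ((c : K) - d) * ∑ i, b i * f i := by ring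
          rw [e, hsc' _ _ (F.sub_mem c.2 d.2)
            (sub_ne_zero.mpr fun h => hne (Subtype.ext h)), hg _ (hφs c)] at h3
          exact lt_irrefl _ h3
        have h1 : (m : Cardinal) ≤ Cardinal.mk s := by
          have := Cardinal.lift_mk_le_lift_mk_of_injective hinj
          have h2 := (Cardinal.lift_le.mpr hF).trans this
          simpa using h2
        have h2 : m ≤ s.card := by simpa using h1
        have h3 := Finset.card_le_univ (insert k s)
        rw [Finset.card_insert_of_notMem hk, Fintype.card_fin] at h3
        omega
      obtain ⟨c, hc⟩ := hex
      refine ⟨_, hmem c c.2, fun j hj => ?_⟩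
      rw [hsum]
      rcases Finset.mem_insert.mp hj with rfl | hj
      · refine le_antisymm ?_ (by rw [← hsum]; exact hL _ (hmem c c.2) _)
        by_contra hlt
        rw [not_le] at hlt
        have h1 : ((-(α j) : ℤ) : WithTop ℤ) < v j (-((c : K) * ∑ i, b i * f i)) := by
          rw [hneg]
          by_cases h0 : (c : K) = 0
          · rw [h0, zero_mul, hv0]; exact WithTop.coe_lt_top _
          · rw [hsc' _ _ c.2 h0]; exact hgk
        have h2 := (lt_min hlt h1).trans_le (hvadd _ _ _)
        rw [add_neg_cancel_right, heq] at h2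
        exact lt_irrefl _ h2
      · exact hc j hj
  obtain ⟨b, hb, h⟩ := key Finset.univ
  exact ⟨b, hb, fun j => h j (Finset.mem_univ j)⟩
end

section
/- Let m ≥ 1, I = {1,…,m}, and let ℓ : ℤ^m → ℤ be any function. Define d_i(β) = ℓ(β) − ℓ(β − e_i), d(β) = ℓ(β) − ℓ(β − 𝟙), p_i(α) = (−1)^{m−1} Σ_{J ⊆ I∖{i}} (−1)^{#J} d_i(α − 𝟙 + 𝟙_J + e_i), and q(α) = Σ_{J ⊆ I} (−1)^{#J} d(α − 𝟙_J). Then for every α ∈ ℤ^m and every i ∈ I one has p_i(α) − p_i(α − 𝟙) = q(α); equivalently, the formal series satisfy (1 − t_1⋯t_m) · P(t) = Q(t), where P(t) = Σ_α p_i(α) t^α and Q(t) = Σ_α q(α) t^α. -/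
open Finset

variable {m : ℕ}

/-- The indicator vector `𝟙_J ∈ ℤ^m` of a subset `J ⊆ {1,…,m}`. -/
def indJ (J : Finset (Fin m)) : Fin m → ℤ := fun j => if j ∈ J then 1 else 0

/-- `d_i(β) = ℓ(β) - ℓ(β - e_i)`. -/
def dcoef (ℓ : (Fin m → ℤ) → ℤ) (i : Fin m) (β : Fin m → ℤ) : ℤ :=
  ℓ β - ℓ (β - Pi.single i 1)

/-- `d(β) = ℓ(β) - ℓ(β - 𝟙)`. -/
def dfull (ℓ : (Fin m → ℤ) → ℤ) (β : Fin m → ℤ) : ℤ := ℓ β - ℓ (β - 1)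

/-- `p_i(α) = (-1)^(m-1) Σ_{J ⊆ I∖{i}} (-1)^{#J} d_i(α - 𝟙 + 𝟙_J + e_i)`. -/
def pcoef (ℓ : (Fin m → ℤ) → ℤ) (i : Fin m) (α : Fin m → ℤ) : ℤ :=
  (-1 : ℤ) ^ (m - 1) *
    ∑ J ∈ ((Finset.univ : Finset (Fin m)).erase i).powerset,
      (-1 : ℤ) ^ J.card * dcoef ℓ i (α - 1 + indJ J + Pi.single i 1)

/-- `q(α) = Σ_{J ⊆ I} (-1)^{#J} d(α - 𝟙_J)`, the coefficients of
`Q(t) = Π (1 - t_i) · L(t)`. -/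
def qcoef (ℓ : (Fin m → ℤ) → ℤ) (α : Fin m → ℤ) : ℤ :=
  ∑ J ∈ (Finset.univ : Finset (Fin m)).powerset,
    (-1 : ℤ) ^ J.card * dfull ℓ (α - indJ J)

theorem pcoef_eq_aux (ℓ : (Fin m → ℤ) → ℤ) (i : Fin m) (α : Fin m → ℤ) :
    pcoef ℓ i α = ∑ J ∈ (Finset.univ : Finset (Fin m)).powerset,
      (-1 : ℤ) ^ J.card * ℓ (α - indJ J) := by
  have hi : i ∉ (Finset.univ : Finset (Fin m)).erase i := by simp
  conv_rhs => rw [← Finset.insert_erase (Finset.mem_univ i), Finset.sum_powerset_insert hi,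
    ← Finset.sum_add_distrib]
  unfold pcoef
  rw [Finset.mul_sum]
  refine Finset.sum_bij' (fun J _ => Finset.univ.erase i \ J)
    (fun J _ => Finset.univ.erase i \ J) ?_ ?_ ?_ ?_ ?_
  · intro J _
    simp
  · intro J _
    simp
  · intro J hJ
    exact Finset.sdiff_sdiff_eq_self (Finset.mem_powerset.1 hJ)
  · intro J hJ
    exact Finset.sdiff_sdiff_eq_self (Finset.mem_powerset.1 hJ)
  · intro J hJ
    have hJ' := Finset.mem_powerset.1 hJ
    have hiJ : i ∉ J := fun h => hi (hJ' h)
    have hiK : i ∉ Finset.univ.erase i \ J := by simp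
    have hc := Finset.card_sdiff_add_card_eq_card hJ'
    rw [Finset.card_erase_of_mem (Finset.mem_univ i), Finset.card_univ, Fintype.card_fin] at hc
    rw [Finset.card_insert_of_notMem hiK, ← hc]
    have h1 : α - 1 + indJ J + Pi.single i 1 = α - indJ (Finset.univ.erase i \ J) := by
      funext j
      by_cases hj : j = i
      · subst hj
        simp [indJ, hiJ]
      · by_cases hjJ : j ∈ J <;> simp [indJ, hj, hjJ]
    have h2 : α - indJ (Finset.univ.erase i \ J) - Pi.single i 1
        = α - indJ (insert i (Finset.univ.erase i \ J)) := by
      funext j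
      by_cases hj : j = i
      · subst hj
        simp [indJ]
      · by_cases hjJ : j ∈ J <;> simp [indJ, hj, hjJ]
    have h3 : (-1 : ℤ) ^ J.card * (-1 : ℤ) ^ J.card = 1 := by
      rw [← mul_pow]; simp
    unfold dcoef
    rw [h1, h2, pow_add, pow_succ]
    linear_combination ((-1 : ℤ) ^ (Finset.univ.erase i \ J).card *
      (ℓ (α - indJ (Finset.univ.erase i \ J)) -
        ℓ (α - indJ (insert i (Finset.univ.erase i \ J))))) * h3

/-- for any function `ℓ : ℤ^m → ℤ` (`m ≥ 1`), one has
`p_i(α) - p_i(α - 𝟙) = q(α)` for every `α` and every `i`; equivalently the formal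
series satisfy `(1 - t_1⋯t_m) · P(t) = Q(t)`. -/
theorem statement2 (hm : 1 ≤ m) (ℓ : (Fin m → ℤ) → ℤ) (i : Fin m) (α : Fin m → ℤ) :
    pcoef ℓ i α - pcoef ℓ i (α - 1) = qcoef ℓ α := by
  rw [pcoef_eq_aux, pcoef_eq_aux, ← Finset.sum_sub_distrib]
  unfold qcoef dfull
  refine Finset.sum_congr rfl fun J _ => ?_
  rw [sub_right_comm α 1 (indJ J)]
  ring
end

section
/- Let m ≥ 2, I = {1,…,m}, H ⊆ ℤ^m, and let ℓ : ℤ^m → ℤ be monotone with respect to the coordinatewise order and satisfy: (P1→) if α ∈ H then ℓ(α) = ℓ(α − e_i) + 1 for every i ∈ I; (P2) for every γ ∈ ℤ^m and i ∈ I, ∇_i^m(γ) = ∅ if and only if ℓ(γ) = ℓ(γ − e_i). Then for α ∈ H the following are equivalent: (i) α is absolute maximal (∇_J(α) = ∅ for every nonempty J ⊊ I); (ii) ∇_i^m(α) = {α} for all i ∈ I; (iii) ∇_i^m(α) = {α} for some i ∈ I; (iv) ℓ(α) = ℓ(α − 𝟙) + 1. -/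
open Finset

variable {m : ℕ}

/-- `∇_J(α) = {β ∈ H : β_j = α_j ∀ j ∈ J, β_i < α_i ∀ i ∉ J}`. -/
def nablaJ (H : Set (Fin m → ℤ)) (J : Finset (Fin m)) (α : Fin m → ℤ) : Set (Fin m → ℤ) :=
  {β | β ∈ H ∧ (∀ j ∈ J, β j = α j) ∧ ∀ i ∉ J, β i < α i}

/-- `∇_i^m(α) = {β ∈ H : β_i = α_i and β_j ≤ α_j for j ≠ i}`. -/
def nablaIm (H : Set (Fin m → ℤ)) (i : Fin m) (α : Fin m → ℤ) : Set (Fin m → ℤ) :=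
  {β | β ∈ H ∧ β i = α i ∧ ∀ j ≠ i, β j ≤ α j}

/-- Proposition 3.2 of the paper: under the hypotheses
(monotonicity of `ℓ`, (P1→) and (P2)), for `α ∈ H` the four conditions
(i) `α` absolute maximal, (ii) `∇_i^m(α) = {α}` for all `i`,
(iii) `∇_i^m(α) = {α}` for some `i`, (iv) `ℓ(α) = ℓ(α - 𝟙) + 1` are equivalent. -/
theorem statement3 (hm : 2 ≤ m) (H : Set (Fin m → ℤ)) (ℓ : (Fin m → ℤ) → ℤ)
    (hmono : Monotone ℓ)
    (hP1 : ∀ α ∈ H, ∀ i : Fin m, ℓ α = ℓ (α - Pi.single i 1) + 1)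
    (hP2 : ∀ (γ : Fin m → ℤ) (i : Fin m),
      nablaIm H i γ = ∅ ↔ ℓ γ = ℓ (γ - Pi.single i 1))
    (α : Fin m → ℤ) (hα : α ∈ H) :
    List.TFAE
      [ ∀ J : Finset (Fin m), J.Nonempty → J ≠ Finset.univ → nablaJ H J α = ∅,
        ∀ i : Fin m, nablaIm H i α = {α},
        ∃ i : Fin m, nablaIm H i α = {α},
        ℓ α = ℓ (α - 1) + 1 ] := by
  have h12 : (∀ J : Finset (Fin m), J.Nonempty → J ≠ Finset.univ → nablaJ H J α = ∅) →
      ∀ i : Fin m, nablaIm H i α = {α} := by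
    intro h i
    ext β
    constructor
    · rintro ⟨hβ, hi, hj⟩
      by_contra hne
      have hne' : ∃ j, β j ≠ α j := by
        by_contra! hc
        exact hne (funext hc)
      obtain ⟨j, hjne⟩ := hne'
      have he := h (Finset.univ.filter fun k => β k = α k) ⟨i, by simp [hi]⟩ (by
        intro hu
        have := Finset.mem_univ j
        rw [← hu] at this
        simp at this
        exact hjne this)
      have hmem : β ∈ nablaJ H (Finset.univ.filter fun k => β k = α k) α := by
        refine ⟨hβ, fun k hk => by simpa using hk, fun k hk => ?_⟩
        have hk' : β k ≠ α k := by simpa using hk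
        have hki : k ≠ i := by
          rintro rfl
          exact hk' hi
        exact lt_of_le_of_ne (hj k hki) hk'
      rw [he] at hmem
      exact hmem
    · intro hb
      have hb' : β = α := hb
      subst hb'
      exact ⟨hα, rfl, fun _ _ => le_rfl⟩
  have h21 : (∀ i : Fin m, nablaIm H i α = {α}) →
      ∀ J : Finset (Fin m), J.Nonempty → J ≠ Finset.univ → nablaJ H J α = ∅ := by
    intro h J ⟨i, hi⟩ hJ
    rw [Set.eq_empty_iff_forall_notMem]
    rintro β ⟨hβ, h1, h2⟩
    have hmem : β ∈ nablaIm H i α := by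
      refine ⟨hβ, h1 i hi, fun j _ => ?_⟩
      by_cases hj : j ∈ J
      · exact (h1 j hj).le
      · exact (h2 j hj).le
    rw [h i] at hmem
    have hb' : β = α := hmem
    subst hb'
    apply hJ
    ext j
    simp only [Finset.mem_univ, iff_true]
    by_contra hj
    exact lt_irrefl _ (h2 j hj)
  have h42 : ℓ α = ℓ (α - 1) + 1 → ∀ i : Fin m, nablaIm H i α = {α} := by
    intro h i
    ext β
    constructor
    · rintro ⟨hβ, hi, hj⟩
      by_contra hne
      have hne' : ∃ j, β j ≠ α j := by
        by_contra! hc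
        exact hne (funext hc)
      obtain ⟨j, hjne⟩ := hne'
      have hji : j ≠ i := by
        rintro rfl
        exact hjne hi
      have hlt := lt_of_le_of_ne (hj j hji) hjne
      have hmem : β ∈ nablaIm H i (α - Pi.single j 1) := by
        refine ⟨hβ, by simp [Pi.single_apply, hi, hji.symm], fun k hk => ?_⟩
        have := hj k hk
        by_cases hkj : k = j
        · subst hkj
          simp
          omega
        · simp [Pi.single_apply, hkj, this]
      have hn : ℓ (α - Pi.single j 1) ≠ ℓ (α - Pi.single j 1 - Pi.single i 1) := by
        intro hc
        rw [(hP2 _ _).2 hc] at hmem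
        exact hmem
      have hle1 : ℓ (α - Pi.single j 1 - Pi.single i 1) ≤ ℓ (α - Pi.single j 1) := by
        apply hmono
        intro k
        simp only [Pi.sub_apply, Pi.single_apply]
        split_ifs <;> omega
      have hle2 : ℓ (α - 1) ≤ ℓ (α - Pi.single j 1 - Pi.single i 1) := by
        apply hmono
        intro k
        simp only [Pi.sub_apply, Pi.single_apply, Pi.one_apply]
        split_ifs with a b
        · exact absurd (a.symm.trans b) hji
        all_goals omega
      have := hP1 α hα j
      omega
    · intro hb
      have hb' : β = α := hb
      subst hb'
      exact ⟨hα, rfl, fun _ _ => le_rfl⟩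
  have h34 : (∃ i : Fin m, nablaIm H i α = {α}) → ℓ α = ℓ (α - 1) + 1 := by
    rintro ⟨i, h⟩
    have hemp : ∀ k, k ≠ i → nablaIm H k (α - Pi.single i 1) = ∅ := by
      intro k hk
      have h1 : nablaIm H i (α - Pi.single k 1) = ∅ := by
        rw [Set.eq_empty_iff_forall_notMem]
        rintro β ⟨hβ, hi, hj⟩
        have hkk := hj k hk
        simp at hkk
        have hmem : β ∈ nablaIm H i α := by
          refine ⟨hβ, by simpa [Pi.single_apply, hk.symm] using hi, fun j hji => ?_⟩
          have := hj j hji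
          simp only [Pi.sub_apply, Pi.single_apply] at this
          split_ifs at this <;> omega
        rw [h] at hmem
        have hb' : β = α := hmem
        subst hb'
        omega
      rw [hP2] at h1 ⊢
      rw [sub_right_comm, ← h1]
      have a1 := hP1 α hα i
      have a2 := hP1 α hα k
      omega
    have hS : ∀ S : Finset (Fin m), i ∉ S →
        ℓ (α - Pi.single i 1 - ∑ k ∈ S, Pi.single k 1) = ℓ (α - Pi.single i 1) := by
      intro S
      induction S using Finset.induction_on with
      | empty => simp
      | insert k S hkS ih =>
        intro hi
        simp only [Finset.mem_insert, not_or] at hi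
        rw [Finset.sum_insert hkS, add_comm, ← sub_sub, ← ih hi.2]
        symm
        rw [← hP2, Set.eq_empty_iff_forall_notMem]
        rintro β ⟨hβ, hk, hj⟩
        have hnn : ∀ j, (∑ k ∈ S, (Pi.single k 1 : Fin m → ℤ)) j = if j ∈ S then 1 else 0 := by
          intro j
          simp [Finset.sum_apply, Pi.single_apply]
        have hmem : β ∈ nablaIm H k (α - Pi.single i 1) := by
          refine ⟨hβ, ?_, fun j hjk => ?_⟩
          · rw [hk, Pi.sub_apply _ (∑ k ∈ S, _), hnn, if_neg hkS, sub_zero]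
          · have := hj j hjk
            rw [Pi.sub_apply _ (∑ k ∈ S, _), hnn] at this
            split_ifs at this <;> omega
        rw [hemp k (Ne.symm hi.1)] at hmem
        exact hmem
    have hfin := hS (Finset.univ.erase i) (by simp)
    have he : α - Pi.single i 1 - ∑ k ∈ Finset.univ.erase i, Pi.single k 1 = α - 1 := by
      rw [sub_sub, Finset.add_sum_erase _ (fun k => (Pi.single k 1 : Fin m → ℤ)) (Finset.mem_univ i)]
      congr 1
      ext j
      simp [Finset.sum_apply, Pi.single_apply]
    rw [he] at hfin
    rw [hfin]
    exact hP1 α hα i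
  tfae_have 1 → 2 := h12
  tfae_have 2 → 1 := h21
  tfae_have 2 → 3 := fun h => ⟨⟨0, by omega⟩, h _⟩
  tfae_have 3 → 4 := h34
  tfae_have 4 → 2 := h42
  tfae_finish
end

section
/- Let m ≥ 2, I = {1,…,m}, H ⊆ ℤ^m, and let ℓ : ℤ^m → ℤ be monotone with respect to the coordinatewise order and satisfy (P1→) and (P2). Assume moreover that lub(β, β′) ∈ H for all β, β′ ∈ H (where lub denotes the coordinatewise maximum), and that |β| ≥ 0 for every β ∈ H. Let Γ be the set of absolute maximal elements of H. Then H = { lub(β^1,…,β^m) : β^1,…,β^m ∈ Γ }. -/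
open Finset

variable {m : ℕ}

/-- The set `Γ` of absolute maximal elements of `H`:
those `α ∈ H` with `∇_J(α) = ∅` for every nonempty proper `J ⊊ I`. -/
def GamSet (H : Set (Fin m → ℤ)) : Set (Fin m → ℤ) :=
  {α | α ∈ H ∧ ∀ J : Finset (Fin m), J.Nonempty → J ≠ Finset.univ → nablaJ H J α = ∅}

/-- Theorem 3.4 of the paper: under the hypotheses, `H` is exactly
the set of least upper bounds (coordinatewise maxima) of `m`-tuples of absolute
maximal elements of `H`. -/
theorem statement4 (hm : 2 ≤ m) (H : Set (Fin m → ℤ)) (ℓ : (Fin m → ℤ) → ℤ)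
    (hmono : Monotone ℓ)
    (hP1 : ∀ α ∈ H, ∀ i : Fin m, ℓ α = ℓ (α - Pi.single i 1) + 1)
    (hP2 : ∀ (γ : Fin m → ℤ) (i : Fin m),
      nablaIm H i γ = ∅ ↔ ℓ γ = ℓ (γ - Pi.single i 1))
    (hlub : ∀ β ∈ H, ∀ β' ∈ H, (fun j => max (β j) (β' j)) ∈ H)
    (hpos : ∀ β ∈ H, 0 ≤ ∑ j, β j) :
    H = {γ | ∃ b : Fin m → (Fin m → ℤ), (∀ k, b k ∈ GamSet H) ∧
          ∀ j, IsGreatest (Set.range fun k => b k j) (γ j)} := by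
  have key : ∀ α ∈ H, ∀ i : Fin m, ∃ β ∈ GamSet H, β i = α i ∧ β ≤ α := by
    intro α hα i
    have hex : ∃ n : ℕ, ∃ β ∈ H, β i = α i ∧ β ≤ α ∧ ∑ j, β j = (n : ℤ) :=
      ⟨(∑ j, α j).toNat, α, hα, rfl, le_refl _, (Int.toNat_of_nonneg (hpos α hα)).symm⟩
    classical
    obtain ⟨β, hβ, hβi, hβα, hsum⟩ := Nat.find_spec hex
    have hmin : ∀ δ ∈ H, δ i = β i → δ ≤ β → ∀ k, β k ≤ δ k := by
      intro δ hδ hδi hδβ k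
      by_contra hk
      have hlt : ∑ j, δ j < ∑ j, β j :=
        Finset.sum_lt_sum (fun j _ => hδβ j) ⟨k, Finset.mem_univ _, not_le.mp hk⟩
      have h0 := hpos δ hδ
      refine Nat.find_min hex (m := (∑ j, δ j).toNat) (by omega)
        ⟨δ, hδ, hδi.trans hβi, hδβ.trans hβα, (Int.toNat_of_nonneg h0).symm⟩
    refine ⟨β, ⟨hβ, ?_⟩, hβi, hβα⟩
    intro J hJ hJu
    by_contra hne
    obtain ⟨δ, hδ, hδJ, hδn⟩ := Set.nonempty_iff_ne_empty.mpr hne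
    have hδβ : δ ≤ β := by
      intro k
      by_cases hk : k ∈ J
      · exact (hδJ k hk).le
      · exact (hδn k hk).le
    by_cases hi : i ∈ J
    · obtain ⟨k, hk⟩ : ∃ k, k ∉ J := by
        by_contra! h
        exact hJu (Finset.eq_univ_iff_forall.mpr h)
      exact absurd (hmin δ hδ (hδJ i hi) hδβ k) (not_le.mpr (hδn k hk))
    · obtain ⟨j, hj⟩ := hJ
      have hij : j ≠ i := fun h => hi (h ▸ hj)
      have h1 : nablaIm H i (β - Pi.single j 1) ≠ ∅ := by
        intro he
        have e1 := (hP2 _ _).mp he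
        have e2 := hP1 β hβ i
        have e3 := hP1 β hβ j
        have e4 : β - Pi.single j 1 - Pi.single i 1
            = β - Pi.single i 1 - (Pi.single j 1 : Fin m → ℤ) := sub_right_comm _ _ _
        rw [e4] at e1
        have e5 : nablaIm H j (β - Pi.single i 1) = ∅ := (hP2 _ _).mpr (by linarith)
        have : δ ∈ nablaIm H j (β - Pi.single i 1) := by
          refine ⟨hδ, by simp [hij, hδJ j hj], ?_⟩
          intro k hk
          by_cases hki : k = i
          · subst hki
            have := hδn k hi
            simp
            omega
          · simpa [hki] using hδβ k
        rw [e5] at this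
        exact this
      obtain ⟨ε, hε, hεi, hεl⟩ := Set.nonempty_iff_ne_empty.mpr h1
      have hεj : ε j ≤ β j - 1 := by simpa using hεl j hij
      have hεi' : ε i = β i := by simpa [hij.symm] using hεi
      have hεβ : ε ≤ β := by
        intro k
        by_cases hki : k = i
        · rw [hki, hεi']
        · by_cases hkj : k = j
          · rw [hkj]
            exact hεj.trans (by linarith)
          · simpa [hkj] using hεl k hki
      have := hmin ε hε hεi' hεβ j
      omega
  ext γ
  constructor
  · intro hγ
    choose b hb hbi hbl using key γ hγ
    refine ⟨b, hb, fun j => ⟨⟨j, hbi j⟩, ?_⟩⟩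
    rintro _ ⟨k, rfl⟩
    exact hbl k j
  · rintro ⟨b, hb, hg⟩
    have hne : (Finset.univ : Finset (Fin m)).Nonempty := ⟨⟨0, by omega⟩, Finset.mem_univ _⟩
    have hs : Finset.univ.sup' hne b ∈ H :=
      Finset.sup'_induction hne b (p := fun x => x ∈ H)
        (fun x hx y hy => hlub x hx y hy) (fun k _ => (hb k).1)
    have : γ = Finset.univ.sup' hne b := by
      funext j
      rw [Finset.sup'_apply]
      apply le_antisymm
      · obtain ⟨k, hk⟩ := (hg j).1
        rw [← hk]
        exact Finset.le_sup' (fun k => b k j) (Finset.mem_univ k)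
      · exact Finset.sup'_le _ _ fun k _ => (hg j).2 ⟨k, rfl⟩
    rw [this]
    exact hs
end

section
/- Let m ≥ 2, I = {1,…,m}, H ⊆ ℤ^m, and let ℓ : ℤ^m → ℤ be monotone with respect to the coordinatewise order, with ℓ(β) = 0 whenever |β| < 0, and satisfying (P1→), (P2), and (P4): ℓ(γ) − ℓ(γ − e_i) ∈ {0, 1} for all γ ∈ ℤ^m, i ∈ I. Let Γ be the set of absolute maximal elements of H and, for α ∈ ℤ^m, let Γ(α) = {β ∈ Γ : β ≤ α} (a finite set). Then for every α ∈ ℤ^m and every i ∈ I, ℓ(α) equals the number of distinct i-th coordinates of elements of Γ(α), i.e. ℓ(α) = #(Γ(α)/≡_i) where β ≡_i β′ iff β_i = β′_i; in particular #(Γ(α)/≡_i) does not depend on i. -/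
open Finset

variable {m : ℕ}

theorem aux_sum_nonneg (H : Set (Fin m → ℤ)) (ℓ : (Fin m → ℤ) → ℤ)
    (hneg : ∀ β : Fin m → ℤ, (∑ j, β j) < 0 → ℓ β = 0)
    (hP1 : ∀ α ∈ H, ∀ i : Fin m, ℓ α = ℓ (α - Pi.single i 1) + 1)
    (i : Fin m) (β : Fin m → ℤ) (hβ : β ∈ H) : 0 ≤ ∑ j, β j := by
  by_contra h
  push Not at h
  have h1 := hP1 β hβ i
  have h2 := hneg β h
  have h3 := hneg (β - Pi.single i 1) (by simp [Finset.sum_sub_distrib]; omega)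
  omega

theorem aux_exists (H : Set (Fin m → ℤ)) (ℓ : (Fin m → ℤ) → ℤ)
    (hneg : ∀ β : Fin m → ℤ, (∑ j, β j) < 0 → ℓ β = 0)
    (hP1 : ∀ α ∈ H, ∀ i : Fin m, ℓ α = ℓ (α - Pi.single i 1) + 1)
    (hP2 : ∀ (γ : Fin m → ℤ) (i : Fin m),
      nablaIm H i γ = ∅ ↔ ℓ γ = ℓ (γ - Pi.single i 1))
    (hP4 : ∀ (γ : Fin m → ℤ) (i : Fin m),
      ℓ γ - ℓ (γ - Pi.single i 1) = 0 ∨ ℓ γ - ℓ (γ - Pi.single i 1) = 1)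
    (i : Fin m) (n : ℕ) : ∀ β ∈ H, (∑ j, β j) < n → 
      ∃ γ ∈ GamSet H, γ ≤ β ∧ γ i = β i := by
  induction n with
  | zero =>
    intro β hβ h
    have := aux_sum_nonneg H ℓ hneg hP1 i β hβ
    simp at h; omega
  | succ n ih =>
    intro β hβ h
    by_cases hG : β ∈ GamSet H
    · exact ⟨β, hG, le_refl _, rfl⟩
    -- it is enough to find a strictly smaller element of `H`
    suffices hs : ∃ δ ∈ H, δ ≤ β ∧ δ i = β i ∧ ∃ j, δ j < β j by
      obtain ⟨δ, hδ, hle, hi, j, hj⟩ := hs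
      have hlt : ∑ j, δ j < ∑ j, β j :=
        Finset.sum_lt_sum (fun k _ => hle k) ⟨j, Finset.mem_univ _, hj⟩
      obtain ⟨γ, hγ, h1, h2⟩ := ih δ hδ (by push_cast at h; omega)
      exact ⟨γ, hγ, h1.trans hle, h2.trans hi⟩
    have hG' : ∃ J : Finset (Fin m), J.Nonempty ∧ J ≠ Finset.univ ∧ nablaJ H J β ≠ ∅ := by
      by_contra hc
      push Not at hc
      exact hG ⟨hβ, fun J h1 h2 => by simpa using hc J h1 h2⟩
    obtain ⟨J, ⟨j, hj⟩, hJ, hne⟩ := hG'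
    obtain ⟨γ, hγ, hγ1, hγ2⟩ := Set.nonempty_iff_ne_empty.mpr hne
    have hle : γ ≤ β := fun k => by
      by_cases hk : k ∈ J
      · exact (hγ1 k hk).le
      · exact (hγ2 k hk).le
    by_cases hi : i ∈ J
    · obtain ⟨k, hk⟩ : ∃ k, k ∉ J := by
        by_contra hc
        push Not at hc
        exact hJ (Finset.eq_univ_iff_forall.mpr hc)
      exact ⟨γ, hγ, hle, hγ1 i hi, k, hγ2 k hk⟩
    have hij : i ≠ j := fun e => hi (e ▸ hj)
    have e1 := hP1 β hβ i
    have e2 := hP1 β hβ j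
    have e3 : ¬ (ℓ (β - Pi.single i 1) = ℓ (β - Pi.single i 1 - Pi.single j 1)) := by
      rw [← hP2]
      intro he
      have hmem : γ ∈ nablaIm H j (β - Pi.single i 1) := by
        refine ⟨hγ, ?_, fun k _ => ?_⟩
        · simp [hγ1 j hj, hij.symm]
        · by_cases hk : k = i
          · subst hk
            have := hγ2 k hi
            simp; omega
          · simpa [hk] using hle k
      rw [he] at hmem
      exact hmem
    have e4 := hP4 (β - Pi.single i 1) j
    have e5 : ¬ (ℓ (β - Pi.single j 1) = ℓ (β - Pi.single j 1 - Pi.single i 1)) := by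
      rw [sub_right_comm β (Pi.single j 1)]
      omega
    rw [← hP2] at e5
    obtain ⟨δ, hδ, hδ1, hδ2⟩ := Set.nonempty_iff_ne_empty.mpr e5
    have hδi : δ i = β i := by simpa [hij] using hδ1
    have hδj : δ j < β j := by
      have := hδ2 j hij.symm
      simp at this; omega
    refine ⟨δ, hδ, fun k => ?_, hδi, j, hδj⟩
    by_cases hk : k = i
    · subst hk; exact hδi.le
    by_cases hk' : k = j
    · subst hk'; exact hδj.le
    · simpa [hk'] using hδ2 k hk

theorem aux_main (H : Set (Fin m → ℤ)) (ℓ : (Fin m → ℤ) → ℤ)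
    (hneg : ∀ β : Fin m → ℤ, (∑ j, β j) < 0 → ℓ β = 0)
    (hP1 : ∀ α ∈ H, ∀ i : Fin m, ℓ α = ℓ (α - Pi.single i 1) + 1)
    (hP2 : ∀ (γ : Fin m → ℤ) (i : Fin m),
      nablaIm H i γ = ∅ ↔ ℓ γ = ℓ (γ - Pi.single i 1))
    (hP4 : ∀ (γ : Fin m → ℤ) (i : Fin m),
      ℓ γ - ℓ (γ - Pi.single i 1) = 0 ∨ ℓ γ - ℓ (γ - Pi.single i 1) = 1)
    (i : Fin m) (n : ℕ) : ∀ α : Fin m → ℤ, (∑ j, α j) < n →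
      ((fun β : Fin m → ℤ => β i) '' {β | β ∈ GamSet H ∧ β ≤ α}).Finite ∧
      ℓ α = (((fun β => β i) '' {β | β ∈ GamSet H ∧ β ≤ α}).ncard : ℤ) := by
  induction n with
  | zero =>
    intro α h
    have he : {β | β ∈ GamSet H ∧ β ≤ α} = ∅ := by
      ext β
      simp only [Set.mem_setOf_eq, Set.mem_empty_iff_false, iff_false]
      rintro ⟨hβ, hle⟩
      have h1 := aux_sum_nonneg H ℓ hneg hP1 i β hβ.1
      have h2 : ∑ j, β j ≤ ∑ j, α j := Finset.sum_le_sum fun k _ => hle k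
      simp at h; omega
    rw [he]
    simp
    exact hneg α (by simpa using h)
  | succ n ih =>
    intro α h
    obtain ⟨hf, hc⟩ := ih (α - Pi.single i 1) (by
      simp [Finset.sum_sub_distrib]; push_cast at h; omega)
    have hle : α - Pi.single i 1 ≤ α := by
      intro k
      by_cases hk : k = i
      · subst hk; simp
      · simp [hk]
    have hle' : ∀ β : Fin m → ℤ, β ≤ α → β i ≠ α i → β ≤ α - Pi.single i 1 := by
      intro β hβ hne k
      by_cases hk : k = i
      · subst hk
        have h3 : β k ≤ α k := hβ k
        simp; omega
      · simpa [hk] using hβ k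
    by_cases hn : nablaIm H i α = ∅
    · have he : {β | β ∈ GamSet H ∧ β ≤ α} = {β | β ∈ GamSet H ∧ β ≤ α - Pi.single i 1} := by
        ext β
        refine ⟨fun hb => ⟨hb.1, hle' β hb.2 fun e => ?_⟩, fun hb => ⟨hb.1, hb.2.trans hle⟩⟩
        have : β ∈ nablaIm H i α := ⟨hb.1.1, e, fun k _ => hb.2 k⟩
        rw [hn] at this
        exact this
      rw [he, (hP2 α i).mp hn]
      exact ⟨hf, hc⟩
    · have hl : ℓ α = ℓ (α - Pi.single i 1) + 1 := by
        have h1 := hP4 α i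
        have h2 : ¬ (ℓ α = ℓ (α - Pi.single i 1)) := fun e => hn ((hP2 α i).mpr e)
        omega
      obtain ⟨β, hβ, hβi, hβk⟩ := Set.nonempty_iff_ne_empty.mpr hn
      have hβα : β ≤ α := fun k => by
        by_cases hk : k = i
        · subst hk; exact hβi.le
        · exact hβk k hk
      obtain ⟨γ, hγ, hγβ, hγi⟩ := aux_exists H ℓ hneg hP1 hP2 hP4 i
        ((∑ j, β j).toNat + 1) β hβ (by push_cast; omega)
      have he : ((fun β : Fin m → ℤ => β i) '' {β | β ∈ GamSet H ∧ β ≤ α}) =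
          insert (α i) ((fun β : Fin m → ℤ => β i) ''
            {β | β ∈ GamSet H ∧ β ≤ α - Pi.single i 1}) := by
        ext x
        constructor
        · rintro ⟨δ, ⟨hδ, hδα⟩, rfl⟩
          by_cases hx : δ i = α i
          · exact Or.inl hx
          · exact Or.inr ⟨δ, ⟨hδ, hle' δ hδα hx⟩, rfl⟩
        · rintro (rfl | ⟨δ, ⟨hδ, hδα⟩, rfl⟩)
          · exact ⟨γ, ⟨hγ, hγβ.trans hβα⟩, hγi.trans hβi⟩
          · exact ⟨δ, ⟨hδ, hδα.trans hle⟩, rfl⟩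
      have hni : α i ∉ ((fun β : Fin m → ℤ => β i) ''
            {β | β ∈ GamSet H ∧ β ≤ α - Pi.single i 1}) := by
        rintro ⟨δ, ⟨hδ, hδα⟩, hx⟩
        have := hδα i
        simp at this hx; omega
      rw [he, Set.ncard_insert_of_notMem hni hf, hl, hc]
      exact ⟨hf.insert _, by push_cast; rfl⟩

/-- Theorem 3.5 of the paper: under the hypotheses, for every
`α ∈ ℤ^m` and every `i`, `ℓ(α)` equals the number of distinct `i`-th coordinates
of elements of `Γ(α) = {β ∈ Γ : β ≤ α}`, i.e. `ℓ(α) = #(Γ(α)/≡_i)`. -/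
theorem statement5 (hm : 2 ≤ m) (H : Set (Fin m → ℤ)) (ℓ : (Fin m → ℤ) → ℤ)
    (hmono : Monotone ℓ)
    (hneg : ∀ β : Fin m → ℤ, (∑ j, β j) < 0 → ℓ β = 0)
    (hP1 : ∀ α ∈ H, ∀ i : Fin m, ℓ α = ℓ (α - Pi.single i 1) + 1)
    (hP2 : ∀ (γ : Fin m → ℤ) (i : Fin m),
      nablaIm H i γ = ∅ ↔ ℓ γ = ℓ (γ - Pi.single i 1))
    (hP4 : ∀ (γ : Fin m → ℤ) (i : Fin m),
      ℓ γ - ℓ (γ - Pi.single i 1) = 0 ∨ ℓ γ - ℓ (γ - Pi.single i 1) = 1)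
    (α : Fin m → ℤ) (i : Fin m) :
    ℓ α = (((fun β => β i) '' {β | β ∈ GamSet H ∧ β ≤ α}).ncard : ℤ) := by
  exact (aux_main H ℓ hneg hP1 hP2 hP4 i ((∑ j, α j).toNat + 1) α (by push_cast; omega)).2
end

section
/- Let m ≥ 2, I = {1,…,m}, let H ⊆ ℤ^m be closed under addition, and let η ∈ ℤ^m satisfy η ∈ H and −η ∈ H. Let ℓ : ℤ^m → ℤ satisfy ℓ(β) = 0 whenever |β| < 0, together with (P2) and (P4). Then ℓ(α + η) = ℓ(α) for every α ∈ ℤ^m. -/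
open Finset

variable {m : ℕ}

/-- Corollary 3.8 of the paper: if `H ⊆ ℤ^m` is closed under
addition, `η ∈ H` and `-η ∈ H`, and `ℓ` vanishes on tuples of negative
coordinate sum and satisfies (P2) and (P4), then `ℓ(α + η) = ℓ(α)` for all `α`. -/
theorem statement6 (hm : 2 ≤ m) (H : Set (Fin m → ℤ))
    (hHadd : ∀ x ∈ H, ∀ y ∈ H, x + y ∈ H)
    (η : Fin m → ℤ) (hη : η ∈ H) (hη' : -η ∈ H)
    (ℓ : (Fin m → ℤ) → ℤ)
    (hneg : ∀ β : Fin m → ℤ, (∑ j, β j) < 0 → ℓ β = 0)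
    (hP2 : ∀ (γ : Fin m → ℤ) (i : Fin m),
      nablaIm H i γ = ∅ ↔ ℓ γ = ℓ (γ - Pi.single i 1))
    (hP4 : ∀ (γ : Fin m → ℤ) (i : Fin m),
      ℓ γ - ℓ (γ - Pi.single i 1) = 0 ∨ ℓ γ - ℓ (γ - Pi.single i 1) = 1)
    (α : Fin m → ℤ) :
    ℓ (α + η) = ℓ α := by
  have shift : ∀ ζ ∈ H, ∀ (γ : Fin m → ℤ) (i : Fin m),
      (nablaIm H i γ).Nonempty → (nablaIm H i (γ + ζ)).Nonempty := by
    rintro ζ hζ γ i ⟨β, hβ, h1, h2⟩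
    refine ⟨β + ζ, hHadd _ hβ _ hζ, ?_, ?_⟩
    · simp [h1]
    · intro j hj
      simpa using h2 j hj
  have key : ∀ (γ : Fin m → ℤ) (i : Fin m),
      ℓ (γ + η) - ℓ γ = ℓ (γ - Pi.single i 1 + η) - ℓ (γ - Pi.single i 1) := by
    intro γ i
    have hiff : nablaIm H i γ = ∅ ↔ nablaIm H i (γ + η) = ∅ := by
      rw [← not_iff_not, ← ne_eq, ← ne_eq, ← Set.nonempty_iff_ne_empty,
        ← Set.nonempty_iff_ne_empty]
      refine ⟨shift η hη γ i, fun h => ?_⟩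
      have := shift (-η) hη' _ i h
      simpa using this
    rw [hP2, hP2] at hiff
    have e : γ + η - Pi.single i 1 = γ - Pi.single i 1 + η := by abel
    have h1 := hP4 γ i
    have h2 := hP4 (γ + η) i
    rw [e] at hiff h2
    omega
  let i : Fin m := ⟨0, by omega⟩
  have iter : ∀ k : ℕ, ℓ (α + η) - ℓ α =
      ℓ (α - Pi.single i (k : ℤ) + η) - ℓ (α - Pi.single i (k : ℤ)) := by
    intro k
    induction k with
    | zero => simp
    | succ k ih =>
      rw [ih, key _ i]
      have e : α - Pi.single i (k : ℤ) - Pi.single i 1 = α - Pi.single i ((k + 1 : ℕ) : ℤ) := by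
        push_cast
        rw [Pi.single_add]
        abel
      rw [e]
  obtain ⟨k, hk⟩ : ∃ k : ℕ, k = (∑ j, α j).natAbs + (∑ j, η j).natAbs + 1 := ⟨_, rfl⟩
  have hs : ∑ j, (Pi.single i (k : ℤ) : Fin m → ℤ) j = k := by simp
  have h := iter k
  have h1 : ℓ (α - Pi.single i (k : ℤ)) = 0 := by
    apply hneg
    simp only [Pi.sub_apply, Finset.sum_sub_distrib, hs]
    omega
  have h2 : ℓ (α - Pi.single i (k : ℤ) + η) = 0 := by
    apply hneg
    simp only [Pi.sub_apply, Pi.add_apply, Finset.sum_add_distrib, Finset.sum_sub_distrib, hs]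
    omega
  omega
end

section
/- Let m ≥ 2 and let H ⊆ ℤ^m be closed under addition. Let a_1,…,a_{m−1} be positive integers, set η^i = a_i(e_i − e_{i+1}) ∈ ℤ^m for i = 1,…,m−1, and assume η^i ∈ H and −η^i ∈ H for every i. Let Θ be the subgroup of ℤ^m generated by η^1,…,η^{m−1} and let C = {α ∈ ℤ^m : 0 ≤ α_i < a_i for i = 1,…,m−1}. Let M and Γ be the sets of maximal and absolute maximal elements of H. Then M = (M ∩ C) + Θ and Γ = (Γ ∩ C) + Θ. -/
open Finset Pointwise

variable {m : ℕ}

/-- `∇(α) = ∪_i ∇_i(α)` where `∇_i(α) = {β ∈ H : β_i = α_i, β_j < α_j ∀ j ≠ i}`. -/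
def nabla (H : Set (Fin m → ℤ)) (α : Fin m → ℤ) : Set (Fin m → ℤ) :=
  {β | β ∈ H ∧ ∃ i : Fin m, β i = α i ∧ ∀ j ≠ i, β j < α j}

/-- The set `M` of maximal elements of `H`: those `α ∈ H` with `∇(α) = ∅`. -/
def MaxSet (H : Set (Fin m → ℤ)) : Set (Fin m → ℤ) :=
  {α | α ∈ H ∧ nabla H α = ∅}

/-- `η^i = a_i (e_i - e_{i+1}) ∈ ℤ^m` for `i = 1, …, m-1`. -/
def eta (a : Fin (m - 1) → ℤ) (i : Fin (m - 1)) : Fin m → ℤ :=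
  a i • (Pi.single (⟨i.1, by have := i.isLt; omega⟩ : Fin m) (1 : ℤ)
       - Pi.single (⟨i.1 + 1, by have := i.isLt; omega⟩ : Fin m) (1 : ℤ))

/-- The lattice `Θ`, i.e. the subgroup of `ℤ^m` generated by `η^1, …, η^{m-1}`. -/
def Theta (a : Fin (m - 1) → ℤ) : AddSubgroup (Fin m → ℤ) :=
  AddSubgroup.closure (Set.range (eta a))

/-- The fundamental region `C = {α ∈ ℤ^m : 0 ≤ α_i < a_i for i = 1, …, m-1}`. -/
def Creg (a : Fin (m - 1) → ℤ) : Set (Fin m → ℤ) :=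
  {α | ∀ i : Fin (m - 1), 0 ≤ α (⟨i.1, by have := i.isLt; omega⟩ : Fin m) ∧
        α (⟨i.1, by have := i.isLt; omega⟩ : Fin m) < a i}

theorem aux_H (H : Set (Fin m → ℤ)) (hm : 2 ≤ m)
    (hHadd : ∀ x ∈ H, ∀ y ∈ H, x + y ∈ H)
    (a : Fin (m - 1) → ℤ)
    (hη : ∀ i, eta a i ∈ H) (hη' : ∀ i, -(eta a i) ∈ H) (t : Fin m → ℤ) (ht : t ∈ Theta a) :
    t ∈ H ∧ -t ∈ H := by
  unfold Theta at ht
  induction ht using AddSubgroup.closure_induction with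
  | mem x hx =>
    obtain ⟨i, rfl⟩ := hx
    exact ⟨hη i, hη' i⟩
  | zero =>
    have h := hHadd _ (hη ⟨0, by omega⟩) _ (hη' ⟨0, by omega⟩)
    rw [add_neg_cancel] at h
    simpa using h
  | add x y _ _ hx hy =>
    refine ⟨hHadd _ hx.1 _ hy.1, ?_⟩
    rw [neg_add]
    exact hHadd _ hx.2 _ hy.2
  | neg x _ hx => exact ⟨hx.2, by simpa using hx.1⟩

theorem aux_red (a : Fin (m - 1) → ℤ) (ha : ∀ i, 0 < a i) (α : Fin m → ℤ) (k : ℕ) :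
    ∃ t ∈ Theta a, ∀ i : Fin (m - 1), i.1 < k →
      0 ≤ (α + t) (⟨i.1, by have := i.isLt; omega⟩ : Fin m) ∧
        (α + t) (⟨i.1, by have := i.isLt; omega⟩ : Fin m) < a i := by
  induction k with
  | zero => exact ⟨0, zero_mem _, fun i hi => absurd hi (by omega)⟩
  | succ k ih =>
    obtain ⟨t, ht, h⟩ := ih
    by_cases hk : k < m - 1
    · let q := (α + t) ⟨k, by omega⟩ / a ⟨k, hk⟩
      refine ⟨t - q • eta a ⟨k, hk⟩, sub_mem ht (zsmul_mem
        (AddSubgroup.subset_closure (Set.mem_range_self _)) _), ?_⟩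
      intro i hi
      rcases Nat.lt_succ_iff_lt_or_eq.mp hi with hlt | heq
      · have := h i hlt
        have h1 : i.1 ≠ k := by omega
        have h2 : i.1 ≠ k + 1 := by omega
        simpa [eta, Pi.single_apply, h1, h2] using this
      · have hik : i = ⟨k, hk⟩ := Fin.ext heq
        subst hik
        have e : (α + (t - q • eta a ⟨k, hk⟩)) (⟨k, by omega⟩ : Fin m)
            = (α + t) ⟨k, by omega⟩ % a ⟨k, hk⟩ := by
          rw [Int.emod_def]
          simp [eta, Pi.single_apply, q]
          ring
        exact ⟨e ▸ Int.emod_nonneg _ (ha _).ne', e ▸ Int.emod_lt_of_pos _ (ha _)⟩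
    · exact ⟨t, ht, fun i _ => h i (by omega)⟩

theorem aux_eq (a : Fin (m - 1) → ℤ) (ha : ∀ i, 0 < a i) (S : Set (Fin m → ℤ))
    (hS : ∀ α ∈ S, ∀ t ∈ Theta a, α + t ∈ S) :
    S = (S ∩ Creg a) + (Theta a : Set (Fin m → ℤ)) := by
  ext α
  rw [Set.mem_add]
  constructor
  · intro h
    obtain ⟨t, ht, hC⟩ := aux_red a ha α (m - 1)
    exact ⟨α + t, ⟨hS α h t ht, fun i => hC i i.2⟩, -t, neg_mem ht, by simp⟩
  · rintro ⟨b, hb, t, ht, rfl⟩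
    exact hS b hb.1 t ht

/-- Theorem 3.9 of the paper: the maximal and absolute maximal
elements of `H` are finitely determined: `M = (M ∩ C) + Θ` and `Γ = (Γ ∩ C) + Θ`. -/
theorem statement7 (hm : 2 ≤ m) (H : Set (Fin m → ℤ))
    (hHadd : ∀ x ∈ H, ∀ y ∈ H, x + y ∈ H)
    (a : Fin (m - 1) → ℤ) (ha : ∀ i, 0 < a i)
    (hη : ∀ i, eta a i ∈ H) (hη' : ∀ i, -(eta a i) ∈ H) :
    MaxSet H = (MaxSet H ∩ Creg a) + (Theta a : Set (Fin m → ℤ)) ∧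
    GamSet H = (GamSet H ∩ Creg a) + (Theta a : Set (Fin m → ℤ)) := by
  have hT := aux_H H hm hHadd a hη hη'
  constructor
  · apply aux_eq a ha
    rintro α ⟨h1, h2⟩ t ht
    refine ⟨hHadd _ h1 _ (hT t ht).1, Set.eq_empty_iff_forall_notMem.mpr ?_⟩
    rintro β ⟨hb, i, hi, hj⟩
    refine Set.eq_empty_iff_forall_notMem.mp h2 (β + -t)
      ⟨hHadd _ hb _ (hT t ht).2, i, ?_, fun j hne => ?_⟩
    · simp [hi]
    · have := hj j hne
      simp only [Pi.add_apply, Pi.neg_apply] at this ⊢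
      omega
  · apply aux_eq a ha
    rintro α ⟨h1, h2⟩ t ht
    refine ⟨hHadd _ h1 _ (hT t ht).1, fun J hJ hJ' => Set.eq_empty_iff_forall_notMem.mpr ?_⟩
    rintro β ⟨hb, hi, hj⟩
    refine Set.eq_empty_iff_forall_notMem.mp (h2 J hJ hJ') (β + -t)
      ⟨hHadd _ hb _ (hT t ht).2, fun i hiJ => ?_, fun j hne => ?_⟩
    · simp [hi i hiJ]
    · have := hj j hne
      simp only [Pi.add_apply, Pi.neg_apply] at this ⊢
      omega
end

section
/- Let m ≥ 2, I = {1,…,m}, let H ⊆ ℤ^m be closed under addition, and let η ∈ ℤ^m satisfy η ∈ H and −η ∈ H. Let ℓ : ℤ^m → ℤ satisfy (P2) and (P4), and define d_i(β) = ℓ(β) − ℓ(β − e_i) and p_i(α) = (−1)^{m−1} Σ_{J ⊆ I∖{i}} (−1)^{#J} d_i(α − 𝟙 + 𝟙_J + e_i). Then the Poincaré coefficients are periodic under η: p_i(α + η) = p_i(α) for every α ∈ ℤ^m and every i ∈ I. -/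
open Finset

variable {m : ℕ}

/-- key step of Theorem 4.5 of the paper: if `H` is closed under
addition, `η ∈ H` and `-η ∈ H`, and `ℓ` satisfies (P2) and (P4), then the
Poincaré coefficients are periodic under `η`: `p_i(α + η) = p_i(α)`. -/
theorem statement8 (hm : 2 ≤ m) (H : Set (Fin m → ℤ))
    (hHadd : ∀ x ∈ H, ∀ y ∈ H, x + y ∈ H)
    (η : Fin m → ℤ) (hη : η ∈ H) (hη' : -η ∈ H)
    (ℓ : (Fin m → ℤ) → ℤ)
    (hP2 : ∀ (γ : Fin m → ℤ) (i : Fin m),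
      nablaIm H i γ = ∅ ↔ ℓ γ = ℓ (γ - Pi.single i 1))
    (hP4 : ∀ (γ : Fin m → ℤ) (i : Fin m),
      ℓ γ - ℓ (γ - Pi.single i 1) = 0 ∨ ℓ γ - ℓ (γ - Pi.single i 1) = 1)
    (α : Fin m → ℤ) (i : Fin m) :
    pcoef ℓ i (α + η) = pcoef ℓ i α := by
  have hd : ∀ β : Fin m → ℤ, dcoef ℓ i (β + η) = dcoef ℓ i β := by
    intro β
    have hempty : nablaIm H i (β + η) = ∅ ↔ nablaIm H i β = ∅ := by
      simp only [Set.eq_empty_iff_forall_notMem]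
      constructor
      · rintro h x ⟨hx, hxi, hxj⟩
        refine h (x + η) ⟨hHadd x hx η hη, ?_, ?_⟩
        · simp [hxi]
        · intro j hj
          simpa using hxj j hj
      · rintro h x ⟨hx, hxi, hxj⟩
        refine h (x + -η) ⟨hHadd x hx _ hη', ?_, ?_⟩
        · simp [hxi]
        · intro j hj
          have := hxj j hj
          simp only [Pi.add_apply, Pi.neg_apply] at this ⊢
          linarith
    rw [hP2, hP2] at hempty
    have h1 := hP4 (β + η) i
    have h2 := hP4 β i
    unfold dcoef
    rw [← sub_eq_zero, ← sub_eq_zero (a := ℓ β)] at hempty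
    omega
  unfold pcoef
  congr 1
  refine Finset.sum_congr rfl fun J _ => ?_
  rw [← hd (α - 1 + indJ J + Pi.single i 1)]
  congr 2
  abel
end

section
/- Let m ≥ 2, I = {1,…,m}, H ⊆ ℤ^m, and let ℓ : ℤ^m → ℤ satisfy: (P1←) if ℓ(α) = ℓ(α − e_i) + 1 for every i ∈ I then α ∈ H; (P2) ∇_i^m(γ) = ∅ iff ℓ(γ) = ℓ(γ − e_i); (P4) ℓ(γ) − ℓ(γ − e_i) ∈ {0,1}. Define d_i(β) = ℓ(β) − ℓ(β − e_i) and p_i(α) = (−1)^{m−1} Σ_{J ⊆ I∖{i}} (−1)^{#J} d_i(α − 𝟙 + 𝟙_J + e_i). If α ∉ H, then p_i(α) = 0 for every i ∈ I. -/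
open Finset

variable {m : ℕ}

/-- Proposition 4.1(a) of the paper: under (P1←), (P2) and (P4),
if `α ∉ H` then `p_i(α) = 0` for every `i`. -/
theorem statement9 (hm : 2 ≤ m) (H : Set (Fin m → ℤ)) (ℓ : (Fin m → ℤ) → ℤ)
    (hP1 : ∀ α : Fin m → ℤ, (∀ i : Fin m, ℓ α = ℓ (α - Pi.single i 1) + 1) → α ∈ H)
    (hP2 : ∀ (γ : Fin m → ℤ) (i : Fin m),
      nablaIm H i γ = ∅ ↔ ℓ γ = ℓ (γ - Pi.single i 1))
    (hP4 : ∀ (γ : Fin m → ℤ) (i : Fin m),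
      ℓ γ - ℓ (γ - Pi.single i 1) = 0 ∨ ℓ γ - ℓ (γ - Pi.single i 1) = 1)
    (α : Fin m → ℤ) (hα : α ∉ H) (i : Fin m) :
    pcoef ℓ i α = 0 := by
  obtain ⟨k, hk⟩ : ∃ k, ℓ α = ℓ (α - Pi.single k 1) := by
    by_contra hcon
    push Not at hcon
    refine hα (hP1 α fun j => ?_)
    rcases hP4 α j with h | h
    · exact absurd (by linarith) (hcon j)
    · linarith
  have hem := (hP2 α k).2 hk
  have key : ∀ γ : Fin m → ℤ, γ k = α k → (∀ j, γ j ≤ α j) →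
      ℓ γ = ℓ (γ - Pi.single k 1) := by
    intro γ h1 h2
    refine (hP2 γ k).1 (Set.eq_empty_iff_forall_notMem.2 ?_)
    rintro β ⟨hb, hb1, hb2⟩
    have hmem : β ∈ nablaIm H k α :=
      ⟨hb, hb1.trans h1, fun j hj => (hb2 j hj).trans (h2 j)⟩
    rw [hem] at hmem
    exact hmem
  unfold pcoef
  refine mul_eq_zero_of_right _ ?_
  by_cases hik : k = i
  · subst hik
    refine Finset.sum_eq_zero fun J hJ => ?_
    have hkJ : k ∉ J := fun h => by simpa using Finset.mem_powerset.1 hJ h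
    refine mul_eq_zero_of_right _ ?_
    unfold dcoef
    refine sub_eq_zero.2 (key _ ?_ fun j => ?_)
    · simp [indJ, hkJ]
    · by_cases hj : j = k
      · subst hj; simp [indJ, hkJ]
      · simp only [indJ, Pi.add_apply, Pi.sub_apply, Pi.one_apply, Pi.single_apply, hj, if_false]
        split_ifs <;> simp
  · have hS : (Finset.univ : Finset (Fin m)).erase i
        = insert k (((Finset.univ : Finset (Fin m)).erase i).erase k) :=
      (Finset.insert_erase (by simp [hik])).symm
    rw [hS, Finset.sum_powerset_insert (by simp), ← Finset.sum_add_distrib]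
    refine Finset.sum_eq_zero fun J hJ => ?_
    have hkJ : k ∉ J := fun h => by simpa using Finset.mem_powerset.1 hJ h
    have hiJ : i ∉ J := fun h => by simpa using Finset.mem_powerset.1 hJ h
    have hI : indJ (insert k J) = indJ J + Pi.single k 1 := by
      funext j
      by_cases hj : j = k
      · subst hj; simp [indJ, hkJ]
      · simp [indJ, hj]
    have hb : ∀ j, (α - 1 + indJ J + Pi.single i 1 + Pi.single k 1 : Fin m → ℤ) j ≤ α j := by
      intro j
      by_cases hj : j = k
      · subst hj; simp [indJ, hkJ, hik]
      · by_cases hj2 : j = i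
        · subst hj2; simp [indJ, hiJ, hj]
        · simp only [indJ, Pi.add_apply, Pi.sub_apply, Pi.one_apply, Pi.single_apply, hj, hj2, if_false]
          split_ifs <;> simp
    have e1 := key (α - 1 + indJ J + Pi.single i 1 + Pi.single k 1)
      (by simp [indJ, hkJ, hik]) hb
    have e2 := key (α - 1 + indJ J + Pi.single i 1 + Pi.single k 1 - Pi.single i 1)
      (by simp [indJ, hkJ, hik]) (fun j => by
        have h0 : (0 : ℤ) ≤ (Pi.single i 1 : Fin m → ℤ) j := by
          simp only [Pi.single_apply]; split_ifs <;> simp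
        have := hb j
        rw [Pi.sub_apply]
        linarith)
    rw [Finset.card_insert_of_notMem hkJ, hI, pow_succ]
    unfold dcoef
    rw [show α - 1 + (indJ J + Pi.single k 1) + Pi.single i 1
      = α - 1 + indJ J + Pi.single i 1 + Pi.single k 1 by abel, e1, e2,
      show α - 1 + indJ J + Pi.single i 1 + Pi.single k 1 - Pi.single k 1
      = α - 1 + indJ J + Pi.single i 1 by abel,
      show α - 1 + indJ J + Pi.single i 1 + Pi.single k 1 - Pi.single i 1 - Pi.single k 1
      = α - 1 + indJ J + Pi.single i 1 - Pi.single i 1 by abel]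
    ring
end

section
/- Let m ≥ 2, I = {1,…,m}, H ⊆ ℤ^m, and let ℓ : ℤ^m → ℤ satisfy: (P1→) if α ∈ H then ℓ(α) = ℓ(α − e_i) + 1 for every i; and the forward direction of (P2): if ∇_i^m(γ) = ∅ then ℓ(γ) = ℓ(γ − e_i). Define d_i(β) = ℓ(β) − ℓ(β − e_i) and p_i(α) = (−1)^{m−1} Σ_{J ⊆ I∖{i}} (−1)^{#J} d_i(α − 𝟙 + 𝟙_J + e_i). If α is absolute maximal (α ∈ Γ), then p_i(α) = 1 for every i ∈ I. -/
open Finset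

variable {m : ℕ}

/-- Proposition 4.1(c) of the paper: under (P1→) and the forward
direction of (P2), if `α` is absolute maximal then `p_i(α) = 1` for every `i`. -/
theorem statement11 (hm : 2 ≤ m) (H : Set (Fin m → ℤ)) (ℓ : (Fin m → ℤ) → ℤ)
    (hP1 : ∀ α ∈ H, ∀ i : Fin m, ℓ α = ℓ (α - Pi.single i 1) + 1)
    (hP2 : ∀ (γ : Fin m → ℤ) (i : Fin m),
      nablaIm H i γ = ∅ → ℓ γ = ℓ (γ - Pi.single i 1))
    (α : Fin m → ℤ) (hα : α ∈ GamSet H) (i : Fin m) :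
    pcoef ℓ i α = 1 := by
  unfold pcoef
  obtain ⟨hH, hmax⟩ := hα
  have key : ∀ J ∈ ((Finset.univ : Finset (Fin m)).erase i).powerset,
      J ≠ (Finset.univ : Finset (Fin m)).erase i →
      (-1 : ℤ) ^ J.card * dcoef ℓ i (α - 1 + indJ J + Pi.single i 1) = 0 := by
    intro J hJ hne
    rw [Finset.mem_powerset] at hJ
    have hiJ : i ∉ J := fun h => by simpa using hJ h
    obtain ⟨k, hk, hkJ⟩ : ∃ k, k ≠ i ∧ k ∉ J := by
      by_contra hcon
      push Not at hcon
      apply hne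
      apply Finset.Subset.antisymm hJ
      intro k hk
      exact hcon k (Finset.ne_of_mem_erase hk)
    have h0 : nablaIm H i (α - 1 + indJ J + Pi.single i 1) = ∅ := by
      rw [Set.eq_empty_iff_forall_notMem]
      rintro β ⟨hβ, hβi, hβj⟩
      have h1 : β i = α i := by simpa [indJ, hiJ] using hβi
      have h2 : ∀ j, β j ≤ α j := by
        intro j
        by_cases hj : j = i
        · subst hj; exact h1.le
        · have := hβj j hj
          by_cases hjJ : j ∈ J <;> simp [indJ, hj, hjJ] at this <;> omega
      have h3 : β k < α k := by
        have := hβj k hk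
        simp [indJ, hk, hkJ] at this
        omega
      have h4 := hmax (Finset.univ.filter fun j => β j = α j) ⟨i, by simp [h1]⟩ (by
        intro h
        have : k ∈ Finset.univ.filter fun j => β j = α j := by rw [h]; simp
        simp at this
        omega)
      have h5 : β ∈ nablaJ H (Finset.univ.filter fun j => β j = α j) α := by
        refine ⟨hβ, fun j hj => by simpa using hj, fun j hj => ?_⟩
        exact lt_of_le_of_ne (h2 j) (by simpa using hj)
      rw [h4] at h5
      exact h5
    have := hP2 _ _ h0
    unfold dcoef
    rw [← this]
    simp
  rw [Finset.sum_eq_single_of_mem _ (Finset.mem_powerset_self _) key]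
  have hv : α - 1 + indJ ((Finset.univ : Finset (Fin m)).erase i) + Pi.single i 1 = α := by
    funext j
    by_cases hj : j = i
    · subst hj; simp [indJ]
    · simp [indJ, hj]
  rw [hv]
  have hd : dcoef ℓ i α = 1 := by
    unfold dcoef
    have := hP1 α hH i
    omega
  rw [hd, Finset.card_erase_of_mem (Finset.mem_univ i), Finset.card_univ, Fintype.card_fin,
    mul_one, ← mul_pow]
  simp
end

section
/- Let m ≥ 2, I = {1,…,m}, let ℓ : ℤ^m → ℤ, σ ∈ ℤ^m, and g ∈ ℤ, and suppose ℓ(α) = |α| + 1 − g + ℓ(σ − α − 𝟙) for every α ∈ ℤ^m. Define d_i(β) = ℓ(β) − ℓ(β − e_i) and p_i(α) = (−1)^{m−1} Σ_{J ⊆ I∖{i}} (−1)^{#J} d_i(α − 𝟙 + 𝟙_J + e_i). Then for every α ∈ ℤ^m and every i ∈ I, p_i(α) = (−1)^m p_i(σ − α); equivalently, the Poincaré series satisfies the functional equation P(t) = (−1)^m t^σ P(t^{−1}). -/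
open Finset

variable {m : ℕ}

/-- Theorem 4.13 of the paper: if `ℓ` satisfies the duality
identity `ℓ(α) = |α| + 1 - g + ℓ(σ - α - 𝟙)`, then `p_i(α) = (-1)^m p_i(σ - α)`
for every `α` and every `i`; equivalently `P(t) = (-1)^m t^σ P(t⁻¹)`. -/
theorem statement13 (hm : 2 ≤ m) (ℓ : (Fin m → ℤ) → ℤ) (σ : Fin m → ℤ) (g : ℤ)
    (hdual : ∀ α : Fin m → ℤ, ℓ α = (∑ j, α j) + 1 - g + ℓ (σ - α - 1))
    (α : Fin m → ℤ) (i : Fin m) :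
    pcoef ℓ i α = (-1 : ℤ) ^ m * pcoef ℓ i (σ - α) := by
  have hd : ∀ β : Fin m → ℤ, dcoef ℓ i β = 1 - dcoef ℓ i (σ - β - 1 + Pi.single i 1) := by
    intro β
    unfold dcoef
    have h1 := hdual β
    have h2 := hdual (β - Pi.single i 1)
    have e1 : σ - (β - Pi.single i 1) - 1 = σ - β - 1 + Pi.single i 1 := by abel
    have e2 : σ - β - 1 + Pi.single i 1 - Pi.single i 1 = σ - β - 1 := by abel
    have e3 : ∑ j, (β - Pi.single i 1 : Fin m → ℤ) j = (∑ j, β j) - 1 := by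
      simp [Finset.sum_sub_distrib]
    rw [e1, e3] at h2
    rw [e2]
    linarith
  unfold pcoef
  set S := (Finset.univ : Finset (Fin m)).erase i with hS
  have hcard : S.card = m - 1 := by simp [hS]
  have hne : S.Nonempty := by
    rw [← Finset.card_pos]; omega
  have h0 : ∑ J ∈ S.powerset, (-1 : ℤ) ^ J.card = 0 :=
    Finset.sum_powerset_neg_one_pow_card_of_nonempty hne
  have hrefl : ∑ J ∈ S.powerset,
      (-1 : ℤ) ^ J.card * dcoef ℓ i (σ - (α - 1 + indJ J + Pi.single i 1) - 1 + Pi.single i 1)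
      = ∑ J ∈ S.powerset, (-1 : ℤ) ^ (m - 1) *
        ((-1 : ℤ) ^ J.card * dcoef ℓ i (σ - α - 1 + indJ J + Pi.single i 1)) := by
    refine Finset.sum_nbij' (fun J => S \ J) (fun J => S \ J) ?_ ?_ ?_ ?_ ?_
    · intro J _
      simp
    · intro J _
      simp
    · intro J hJ
      exact Finset.sdiff_sdiff_eq_self (Finset.mem_powerset.1 hJ)
    · intro J hJ
      exact Finset.sdiff_sdiff_eq_self (Finset.mem_powerset.1 hJ)
    · intro J hJ
      have hJ' := Finset.mem_powerset.1 hJ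
      have hc := Finset.card_sdiff_add_card_eq_card hJ'
      have hv : σ - (α - 1 + indJ J + Pi.single i 1) - 1 + Pi.single i 1
          = σ - α - 1 + indJ (S \ J) + Pi.single i 1 := by
        funext j
        by_cases hj : j = i
        · subst hj
          have : j ∉ J := fun h => by simpa [hS] using hJ' h
          simp [indJ, hS, this]
        · by_cases hjJ : j ∈ J
          · simp [indJ, hS, hj, hjJ]
          · simp [indJ, hS, hj, hjJ]; ring
      have hp : (-1 : ℤ) ^ J.card = (-1) ^ (m - 1) * (-1) ^ (S \ J).card := by
        rw [← hcard, ← hc, pow_add, mul_right_comm, ← pow_add, ← two_mul, pow_mul]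
        simp
      rw [hv, hp, mul_assoc]
  have hsum : ∑ J ∈ S.powerset, (-1 : ℤ) ^ J.card * dcoef ℓ i (α - 1 + indJ J + Pi.single i 1)
      = - ((-1 : ℤ) ^ (m - 1) * ∑ J ∈ S.powerset,
        ((-1 : ℤ) ^ J.card * dcoef ℓ i (σ - α - 1 + indJ J + Pi.single i 1))) := by
    rw [Finset.mul_sum, ← hrefl, Finset.sum_congr rfl (fun J _ => by rw [hd, mul_sub, mul_one]),
      Finset.sum_sub_distrib, h0, zero_sub]
  have hm' : (-1 : ℤ) ^ m = - (-1) ^ (m - 1) := by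
    obtain ⟨k, rfl⟩ : ∃ k, m = k + 1 := ⟨m - 1, by omega⟩
    simp [pow_succ]
  rw [hsum, hm']
  ring
end

section
/- Let m ≥ 2, I = {1,…,m}, let ℓ : ℤ^m → ℤ, σ ∈ ℤ^m, and g ∈ ℤ, and suppose ℓ(α) = |α| + 1 − g + ℓ(σ − α − 𝟙) for every α ∈ ℤ^m. Define d(β) = ℓ(β) − ℓ(β − 𝟙) and q(α) = Σ_{J ⊆ I} (−1)^{#J} d(α − 𝟙_J). Then for every α ∈ ℤ^m, q(α) = (−1)^{m−1} q(σ − α + 𝟙); equivalently, the series Q(t) = Σ_α q(α) t^α satisfies the functional equation Q(t) = (−1)^{m−1} t^σ Q(t^{−1}). -/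
open Finset

variable {m : ℕ}

/-- Corollary 4.14 of the paper: if `ℓ` satisfies the duality
identity `ℓ(α) = |α| + 1 - g + ℓ(σ - α - 𝟙)`, then
`q(α) = (-1)^(m-1) q(σ - α + 𝟙)` for every `α`; equivalently
`Q(t) = (-1)^(m-1) t^σ Q(t⁻¹)`. -/
theorem statement14 (hm : 2 ≤ m) (ℓ : (Fin m → ℤ) → ℤ) (σ : Fin m → ℤ) (g : ℤ)
    (hdual : ∀ α : Fin m → ℤ, ℓ α = (∑ j, α j) + 1 - g + ℓ (σ - α - 1))
    (α : Fin m → ℤ) :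
    qcoef ℓ α = (-1 : ℤ) ^ (m - 1) * qcoef ℓ (σ - α + 1) := by
  have hd : ∀ β, dfull ℓ β = m - dfull ℓ (σ - β) := by
    intro β
    unfold dfull
    have h1 := hdual β
    have h2 := hdual (β - 1)
    have e : σ - (β - 1) - 1 = σ - β := by abel
    rw [e] at h2
    have e2 : ∑ j, (β - 1) j = (∑ j, β j) - m := by
      simp [Finset.sum_sub_distrib]
    rw [e2] at h2
    linarith
  have h0 : ∑ J ∈ (Finset.univ : Finset (Fin m)).powerset, (-1 : ℤ) ^ J.card = 0 := by
    apply Finset.sum_powerset_neg_one_pow_card_of_nonempty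
    exact ⟨⟨0, by omega⟩, Finset.mem_univ _⟩
  have h1 : qcoef ℓ α = - ∑ J ∈ (Finset.univ : Finset (Fin m)).powerset,
      (-1 : ℤ) ^ J.card * dfull ℓ (σ - α + indJ J) := by
    have : qcoef ℓ α = (∑ J ∈ (Finset.univ : Finset (Fin m)).powerset, (-1 : ℤ) ^ J.card) * m
       - ∑ J ∈ (Finset.univ : Finset (Fin m)).powerset,
      (-1 : ℤ) ^ J.card * dfull ℓ (σ - α + indJ J) := by
      unfold qcoef
      rw [Finset.sum_mul, ← Finset.sum_sub_distrib]
      refine Finset.sum_congr rfl fun J _ => ?_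
      rw [hd, show σ - (α - indJ J) = σ - α + indJ J by abel]
      ring
    rw [this, h0]; ring
  rw [h1]
  unfold qcoef
  rw [Finset.mul_sum, ← Finset.sum_neg_distrib]
  refine Finset.sum_bij' (fun J _ => Jᶜ) (fun J _ => Jᶜ) (by simp) (by simp) (by simp) (by simp) ?_
  intro J _
  have e : σ - α + 1 - indJ Jᶜ = σ - α + indJ J := by
    funext j
    by_cases h : j ∈ J <;> simp [indJ, h]
  rw [e]
  have hc : J.card + Jᶜ.card = m := by
    simpa using Finset.card_add_card_compl J
  have hs : (-1 : ℤ) ^ (m - 1) * (-1) ^ Jᶜ.card = - (-1) ^ J.card := by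
    have a : (-1 : ℤ) ^ (m - 1) * (-1) = (-1) ^ J.card * (-1) ^ Jᶜ.card := by
      rw [← pow_succ, ← pow_add, hc]; congr 1; omega
    have b : (-1 : ℤ) ^ Jᶜ.card * (-1) ^ Jᶜ.card = 1 := by
      rw [← mul_pow]; simp
    linear_combination (-(-1 : ℤ) ^ Jᶜ.card) * a - (-1 : ℤ) ^ J.card * b
  rw [← mul_assoc, hs]; ring
end

section
/- Let m ≥ 2, I = {1,…,m}, H ⊆ ℤ^m, and suppose σ ∈ ℤ^m satisfies the symmetry property: for every β ∈ ℤ^m, β ∈ H if and only if ∇(σ − β) = ∅. Then for every maximal element α ∈ M one has σ − α ∈ M; in particular α ↦ σ − α is an involution of M. If moreover 0 ∈ H and |β| ≥ 0 for every β ∈ H, then σ itself is a maximal element of H. -/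
open Finset

variable {m : ℕ}

/-- Remark 4.12(2) of the paper: if `σ` satisfies the symmetry
property `β ∈ H ↔ ∇(σ - β) = ∅`, then `α ↦ σ - α` maps maximal elements to
maximal elements (and is an involution of `M`); if moreover `0 ∈ H` and every
element of `H` has nonnegative coordinate sum, then `σ` itself is maximal. -/
theorem statement15 (hm : 2 ≤ m) (H : Set (Fin m → ℤ)) (σ : Fin m → ℤ)
    (hsym : ∀ β : Fin m → ℤ, β ∈ H ↔ nabla H (σ - β) = ∅) :
    (∀ α ∈ MaxSet H, σ - α ∈ MaxSet H) ∧
    Set.BijOn (fun α => σ - α) (MaxSet H) (MaxSet H) ∧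
    ((0 : Fin m → ℤ) ∈ H → (∀ β ∈ H, 0 ≤ ∑ j, β j) → σ ∈ MaxSet H) := by
  have key : ∀ α ∈ MaxSet H, σ - α ∈ MaxSet H := by
    intro α hα
    refine ⟨(hsym _).2 ?_, (hsym _).1 hα.1⟩
    rw [sub_sub_cancel]
    exact hα.2
  refine ⟨key, ⟨key, fun a _ b _ h => sub_right_injective h, fun α hα =>
    ⟨σ - α, key α hα, sub_sub_cancel σ α⟩⟩, ?_⟩
  intro h0 hpos
  have h : (0 : Fin m → ℤ) ∈ MaxSet H := by
    refine ⟨h0, Set.eq_empty_iff_forall_notMem.2 ?_⟩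
    rintro β ⟨hβ, i, hi, hj⟩
    have : Nontrivial (Fin m) := Fin.nontrivial_iff_two_le.2 hm
    obtain ⟨j, hji⟩ := exists_ne i
    have hlt : ∑ k, β k < ∑ k : Fin m, (0 : ℤ) := by
      refine Finset.sum_lt_sum (fun k _ => ?_) ⟨j, Finset.mem_univ j, hj j hji⟩
      by_cases hk : k = i
      · subst hk
        exact hi.le
      · exact (hj k hk).le
    have := hpos β hβ
    simp at hlt
    omega
  simpa using key 0 h
end
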